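/- (Polarized canonical Erdős–Rado) If λ is an infinite cardinal, r < ω, and ≈ is an equivalence relation on ((2^λ_r)^+)^{r+1}, then there are sets X_0, X_1, …, X_r ⊆ (2^λ_r)^+, each of cardinality λ, such that ≈ is canonical on X_0 × X_1 × ⋯ × X_r; that is, there is I ⊆ {0,…,r} such that for all x, y in this product, x ≈ y if and only if x_i = y_i for all i ∈ I. -/

import Mathlib

open Cardinal

universe u

/-- Iterated cardinal exponentiation: `2^λ_0 = λ` and `2^λ_{r+1} = 2 ^ (2^λ_r)`. -/
def iterExp (lam : Cardinal.{u}) : ℕ → Cardinal.{u}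
  | 0 => lam
  | r + 1 => 2 ^ iterExp lam r

theorem le_iterExp {lam : Cardinal.{u}} (r : ℕ) : lam ≤ iterExp lam r := by
  induction r with
  | zero => exact le_rfl
  | succ r ih => exact ih.trans (cantor _).le

/-- A reflexive symmetric conflict relation on a set admits an independent subset of size at most
`μ` that either has size `μ` or conflicts with every element of the set. -/
theorem exists_independent_card_eq_or_dominating {A : Type u} (μ : Cardinal.{u}) (B : Set A)
    (R : A → A → Prop) (hrefl : ∀ a ∈ B, R a a) (hsymm : ∀ a b, R a b → R b a) :
    ∃ F ⊆ B, #F ≤ μ ∧ (F.Pairwise fun a b => ¬ R a b) ∧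
      (#F = μ ∨ ∀ a ∈ B, ∃ b ∈ F, R a b) := by
  obtain ⟨M, hM⟩ := zorn_subset {F : Set A | F ⊆ B ∧ F.Pairwise fun a b => ¬ R a b} (by
    intro c hc hchain
    refine ⟨⋃₀ c, ⟨Set.sUnion_subset fun s hs => (hc hs).1, ?_⟩,
      fun s hs => Set.subset_sUnion_of_mem hs⟩
    exact (Set.pairwise_sUnion hchain.directedOn).2 fun s hs => (hc hs).2)
  by_cases h : μ ≤ #M
  · obtain ⟨F, hFM, hF⟩ := le_mk_iff_exists_subset.1 h
    exact ⟨F, hFM.trans hM.prop.1, hF.le, hM.prop.2.mono hFM, Or.inl hF⟩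
  · refine ⟨M, hM.prop.1, (not_le.1 h).le, hM.prop.2, Or.inr fun a ha => ?_⟩
    by_contra! hno
    have hins : insert a M ∈ {F : Set A | F ⊆ B ∧ F.Pairwise fun a b => ¬ R a b} :=
      ⟨Set.insert_subset ha hM.prop.1, hM.prop.2.insert fun b hb _ =>
        ⟨hno b hb, fun hba => hno b hb (hsymm _ _ hba)⟩⟩
    have haM : a ∈ M := hM.le_of_ge hins (Set.subset_insert a M) (Set.mem_insert a M)
    exact hno a haM (hrefl a ha)

theorem mk_iUnion_le_of_le {ι A : Type u} {κ : Cardinal.{u}} (hκ : aleph0 ≤ κ) (hι : #ι ≤ κ)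
    (f : ι → Set A) (hf : ∀ i, #(f i) ≤ κ) : #(⋃ i, f i) ≤ κ :=
  (mk_iUnion_le f).trans <| (mul_le_mul' hι (ciSup_le' hf)).trans (mul_eq_self hκ).le

theorem mk_arrow_le_of_le {L P : Type u} {κ : Cardinal.{u}} (hκL : κ ^ #L = κ) (hP : #P ≤ κ) :
    #(L → P) ≤ κ := by
  rw [← power_def]
  exact (power_le_power_right hP).trans hκL.le

/-- A reflection principle: among `κ⁺` functions `q a : P → Q` with `κ ^ #L = κ`, some `q d` is
imitated on every `L`-indexed family of points by `#L` many others, which agree with `q d` there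
if its values lie in `T`, and have pairwise disjoint ranges there if its values avoid `T`. -/
theorem exists_reflecting_point {P A Q Γ L : Type u} {κ : Cardinal.{u}} (hL : aleph0 ≤ #L)
    (hκL : κ ^ #L = κ) (hLκ : #L ≤ κ) (hP : #P ≤ κ) (hΓ : #Γ ≤ κ) (hA : #A = Order.succ κ)
    (q : A → P → Q) (C : A → P → Γ) :
    ∃ (d : A) (T : Set Q), ∀ e : L → P,
      ((∀ l, q d (e l) ∈ T) → ∃ Y : Set A, #Y = #L ∧
        ∀ a ∈ Y, ∀ l, q a (e l) = q d (e l) ∧ C a (e l) = C d (e l)) ∧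
      ((∀ l, q d (e l) ∉ T) → ∃ Y : Set A, #Y = #L ∧
        (∀ a ∈ Y, (∀ l l', q a (e l) = q a (e l') ↔ q d (e l) = q d (e l')) ∧
          ∀ l, C a (e l) = C d (e l)) ∧
        ∀ a ∈ Y, ∀ b ∈ Y, a ≠ b → ∀ l l', q a (e l) ≠ q b (e l')) := by
  have hκ : aleph0 ≤ κ := hL.trans hLκ
  obtain ⟨l₀⟩ : Nonempty L := mk_ne_zero_iff.1 (aleph0_pos.trans_le hL).ne'
  have prod_le {S S' : Type u} (h : #S ≤ κ) (h' : #S' ≤ κ) : #(S × S') ≤ κ := by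
    rw [← mul_def]
    exact (mul_le_mul' h h').trans (mul_eq_self hκ).le
  have hK : #(Set (L × L)) ≤ κ := by
    rw [mk_set, ← mul_def, mul_eq_self hL]
    exact (power_le_power_right ((natCast_lt_aleph0 (n := 2)).le.trans hκ)).trans hκL.le
  let B : (L → P) × Set (L × L) × (L → Γ) → Set A := fun t =>
    {a | (∀ l l', q a (t.1 l) = q a (t.1 l') ↔ (l, l') ∈ t.2.1) ∧ ∀ l, C a (t.1 l) = t.2.2 l}
  have hF := fun t => exists_independent_card_eq_or_dominating #L (B t)
    (fun a b => ∃ l l', q a (t.1 l) = q b (t.1 l')) (fun a _ => ⟨l₀, l₀, rfl⟩)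
    (fun a b ⟨l, l', h⟩ => ⟨l', l, h.symm⟩)
  choose F hFB hFcard hFind hFmax using hF
  let T : Set Q := ⋃ t, Set.range fun z : F t × L => q z.1 (t.1 z.2)
  have hT : #T ≤ κ := mk_iUnion_le_of_le hκ
    (prod_le (mk_arrow_le_of_le hκL hP) (prod_le hK (mk_arrow_le_of_le hκL hΓ))) _
    fun t => mk_range_le.trans (prod_le ((hFcard t).trans hLκ) hLκ)
  let G : (L → P) × (L → T) × (L → Γ) → Set A := fun s =>
    {a | ∀ l, q a (s.1 l) = s.2.1 l ∧ C a (s.1 l) = s.2.2 l}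
  let bad : Set A := ⋃ s : {s // #(G s) ≤ κ}, G s
  have hbad : #bad ≤ κ := mk_iUnion_le_of_le hκ
    ((mk_subtype_le _).trans (prod_le (mk_arrow_le_of_le hκL hP)
      (prod_le (mk_arrow_le_of_le hκL hT) (mk_arrow_le_of_le hκL hΓ)))) _ fun s => s.2
  obtain ⟨d, hd⟩ : ∃ d, d ∉ bad := by
    by_contra! h
    have huniv : bad = Set.univ := Set.eq_univ_of_forall h
    rw [huniv, mk_univ, hA] at hbad
    exact (Order.lt_succ κ).not_ge hbad
  refine ⟨d, T, fun e => ⟨fun h => ?_, fun h => ?_⟩⟩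
  · let s : (L → P) × (L → T) × (L → Γ) :=
      (e, fun l => ⟨q d (e l), h l⟩, fun l => C d (e l))
    have hs : #L ≤ #(G s) := by
      refine hLκ.trans (le_of_not_ge fun hle => hd ?_)
      exact Set.mem_iUnion.2 ⟨⟨s, hle⟩, fun l => ⟨rfl, rfl⟩⟩
    obtain ⟨Y, hYG, hY⟩ := le_mk_iff_exists_subset.1 hs
    exact ⟨Y, hY, fun a ha l => hYG ha l⟩
  · let t : (L → P) × Set (L × L) × (L → Γ) :=
      (e, {z | q d (e z.1) = q d (e z.2)}, fun l => C d (e l))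
    refine ⟨F t, (hFmax t).resolve_right fun hmax => ?_, fun a ha => hFB t ha,
      fun a ha b hb hab l l' heq => hFind t ha hb hab ⟨l, l', heq⟩⟩
    obtain ⟨b, hb, l, l', heq⟩ := hmax d ⟨fun _ _ => Iff.rfl, fun _ => rfl⟩
    exact h l (Set.mem_iUnion.2 ⟨t, (⟨b, hb⟩, l'), heq.symm⟩)

theorem exists_injOn_or_eqOn_const {A Q : Type u} {κ : Cardinal.{u}} (hκ : aleph0 ≤ κ)
    (hA : κ < #A) (q : A → Q) :
    ∃ X : Set A, #X = κ ∧ (Set.InjOn q X ∨ ∃ c, ∀ x ∈ X, q x = c) := by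
  by_cases h : κ ≤ #(Set.range q)
  · obtain ⟨Z, hZ, hZc⟩ := le_mk_iff_exists_subset.1 h
    obtain ⟨X, -, hX⟩ := (Set.surjOn_iff_exists_bijOn_subset (f := q) (s := Set.univ) (t := Z)).1
      (by simpa [Set.SurjOn] using hZ)
    refine ⟨X, ?_, Or.inl hX.2.1⟩
    rw [← hZc, ← Set.BijOn.image_eq hX, mk_image_eq_of_injOn _ _ hX.2.1]
  · by_cases hc : ∃ c, κ ≤ #(q ⁻¹' {c})
    · obtain ⟨c, hc⟩ := hc
      obtain ⟨X, hXc, hX⟩ := le_mk_iff_exists_subset.1 hc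
      exact ⟨X, hX, Or.inr ⟨c, fun x hx => hXc hx⟩⟩
    · push Not at hc h
      have hu : (⋃ c : Set.range q, q ⁻¹' {c.1}) = Set.univ :=
        Set.eq_univ_of_forall fun a => Set.mem_iUnion.2 ⟨⟨q a, a, rfl⟩, rfl⟩
      have := mk_iUnion_le_of_le hκ h.le (fun c : Set.range q => q ⁻¹' {c.1}) fun c => (hc c).le
      rw [hu, mk_univ] at this
      exact absurd hA this.not_gt

/-- The polarized canonical theorem for kernels of functions `q`, with simultaneous homogeneity
for a coloring `C` in at most `λ` colors. -/
theorem polarized_canonical_colored (lam : Cardinal.{u}) (hlam : aleph0 ≤ lam) (r : ℕ) :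
    ∀ {A Q Γ : Type u}, #A = Order.succ (iterExp lam r) → #Γ ≤ lam →
      ∀ (q : (Fin (r + 1) → A) → Q) (C : (Fin (r + 1) → A) → Γ),
      ∃ X : Fin (r + 1) → Set A, (∀ i, #(X i) = lam) ∧
        ∃ (I : Set (Fin (r + 1))) (c : Γ),
          (∀ x, (∀ i, x i ∈ X i) → C x = c) ∧
          ∀ x y : Fin (r + 1) → A, (∀ i, x i ∈ X i) → (∀ i, y i ∈ X i) →
            (q x = q y ↔ ∀ i ∈ I, x i = y i) := by
  induction r with
  | zero =>
    intro A Q Γ hA hΓ q C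
    have hA : #A = Order.succ lam := hA
    obtain ⟨c, hc⟩ : ∃ c, lam < #((fun a => C fun _ => a) ⁻¹' {c}) := by
      by_contra! h
      have := mk_iUnion_le_of_le hlam hΓ _ h
      rw [Set.eq_univ_of_forall fun a => Set.mem_iUnion.2 ⟨C fun _ => a, rfl⟩, mk_univ, hA] at this
      exact (Order.lt_succ lam).not_ge this
    obtain ⟨X, hX, hq⟩ := exists_injOn_or_eqOn_const hlam hc fun a => q fun _ => a.1
    have hfun (x : Fin 1 → A) : x = fun _ => x 0 := funext fun i => by rw [Subsingleton.elim i 0]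
    have hmem (x : Fin 1 → A) (hx : x 0 ∈ Subtype.val '' X) :
        ∃ a ∈ X, x = fun _ => a.1 := by
      obtain ⟨a, ha, h⟩ := hx
      exact ⟨a, ha, by rw [hfun x, h]⟩
    refine ⟨fun _ => Subtype.val '' X, fun _ => by
      rw [mk_image_eq Subtype.val_injective, hX], ?_⟩
    rcases hq with hq | ⟨b, hb⟩
    · refine ⟨Set.univ, c, fun x hx => ?_, fun x y hx hy => ?_⟩
      · obtain ⟨a, -, rfl⟩ := hmem x (hx 0)
        exact a.2
      · obtain ⟨a, ha, rfl⟩ := hmem x (hx 0)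
        obtain ⟨a', ha', rfl⟩ := hmem y (hy 0)
        exact ⟨fun h _ _ => congrArg Subtype.val (hq ha ha' h),
          fun h => congrArg q (funext fun i => h i trivial)⟩
    · refine ⟨∅, c, fun x hx => ?_, fun x y hx hy => ?_⟩
      · obtain ⟨a, -, rfl⟩ := hmem x (hx 0)
        exact a.2
      · obtain ⟨a, ha, rfl⟩ := hmem x (hx 0)
        obtain ⟨a', ha', rfl⟩ := hmem y (hy 0)
        simpa using (hb a ha).trans (hb a' ha').symm
  | succ r ih =>
    intro A Q Γ hA hΓ q C
    classical
    have hr : lam ≤ iterExp lam r := le_iterExp r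
    have hr1 : lam ≤ iterExp lam (r + 1) := le_iterExp (r + 1)
    have hsucc : Order.succ (iterExp lam r) ≤ iterExp lam (r + 1) :=
      Order.succ_le_of_lt (cantor _)
    obtain ⟨D, hD⟩ : ∃ D : Set A, #D = Order.succ (iterExp lam r) :=
      le_mk_iff_exists_set.1 (by rw [hA]; exact hsucc.trans (Order.le_succ _))
    have hpow : iterExp lam (r + 1) ^ #lam.out = iterExp lam (r + 1) := by
      rw [mk_out, iterExp, ← power_mul, mul_eq_left (hlam.trans hr) hr
        (aleph0_pos.trans_le hlam).ne']
    have hP : #(Fin (r + 1) → D) ≤ iterExp lam (r + 1) := by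
      rw [mk_arrow, mk_fin, lift_natCast, lift_uzero, hD]
      exact (power_le_power_right hsucc).trans (power_nat_le (hlam.trans hr1))
    let glue (a : A) (p : Fin (r + 1) → D) : Fin (r + 2) → A := Fin.cons a fun i => (p i).1
    obtain ⟨d, T, hd⟩ := exists_reflecting_point (L := lam.out) (by rwa [mk_out]) hpow
      (by rwa [mk_out]) hP (hΓ.trans hr1) hA (fun a p => q (glue a p)) (fun a p => C (glue a p))
    obtain ⟨X, hX, I, c, hc, hI⟩ := ih (Γ := Γ ⊕ Γ) hD
      (by
        rw [mk_sum, lift_id]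
        exact (add_le_add hΓ hΓ).trans (add_eq_self hlam).le)
      (fun p => q (glue d p))
      (fun p => if q (glue d p) ∈ T then Sum.inl (C (glue d p)) else Sum.inr (C (glue d p)))
    obtain ⟨e, heX, hesurj⟩ : ∃ e : lam.out → Fin (r + 1) → D, (∀ l i, e l i ∈ X i) ∧
        ∀ p, (∀ i, p i ∈ X i) → ∃ l, e l = p := by
      have h (i) : Nonempty (lam.out ≃ X i) := Cardinal.eq.1 (by rw [mk_out, hX])
      obtain ⟨φ⟩ : Nonempty (lam.out ≃ (Fin (r + 1) → lam.out)) := Cardinal.eq.1 (by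
        rw [mk_arrow, mk_fin, lift_natCast, lift_uzero, mk_out]
        exact (power_nat_eq hlam (Nat.succ_pos r)).symm)
      let ψ (i) : lam.out ≃ X i := (h i).some
      refine ⟨fun l i => ψ i (φ l i), fun l i => (ψ i (φ l i)).2, fun p hp => ?_⟩
      refine ⟨φ.symm fun i => (ψ i).symm ⟨p i, hp i⟩, funext fun i => by simp⟩
    have hsplit (Y : Set A) (x : Fin (r + 2) → A)
        (hx : ∀ i, x i ∈ (Fin.cons Y fun i => Subtype.val '' X i : Fin (r + 2) → Set A) i) :
        ∃ a ∈ Y, ∃ l, x = glue a (e l) := by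
      choose p hp hpx using fun i : Fin (r + 1) => hx i.succ
      obtain ⟨l, rfl⟩ := hesurj p hp
      refine ⟨x 0, hx 0, l, ?_⟩
      rw [← Fin.cons_self_tail x]
      have htail : Fin.tail x = fun i => (e l i).1 := funext fun i => (hpx i).symm
      rw [htail]
      rfl
    have hcard (Y : Set A) (hY : #Y = #lam.out) (i) :
        #((Fin.cons Y fun i => Subtype.val '' X i : Fin (r + 2) → Set A) i) = lam := by
      refine Fin.cases ?_ (fun i => ?_) i
      · simp [hY]
      · simp [mk_image_eq Subtype.val_injective, hX]
    have hEe (l l') : q (glue d (e l)) = q (glue d (e l')) ↔ ∀ i ∈ I, e l i = e l' i :=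
      hI _ _ (heX l) (heX l')
    have hce (l) := hc (e l) (heX l)
    rcases c with c | c
    · have hmem (l) : q (glue d (e l)) ∈ T := by
        by_contra h
        simpa [h] using hce l
      obtain ⟨Y, hY, hYe⟩ := (hd e).1 hmem
      refine ⟨_, hcard Y hY, Fin.succ '' I, c, fun x hx => ?_, fun x y hx hy => ?_⟩
      · obtain ⟨a, ha, l, rfl⟩ := hsplit Y x hx
        rw [(hYe a ha l).2]
        simpa [hmem l] using hce l
      · obtain ⟨a, ha, l, rfl⟩ := hsplit Y x hx
        obtain ⟨b, hb, l', rfl⟩ := hsplit Y y hy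
        rw [(hYe a ha l).1, (hYe b hb l').1, hEe]
        simp [glue, Subtype.ext_iff]
    · have hmem (l) : q (glue d (e l)) ∉ T := by
        intro h
        simpa [h] using hce l
      obtain ⟨Y, hY, hYe, hdisj⟩ := (hd e).2 hmem
      refine ⟨_, hcard Y hY, insert 0 (Fin.succ '' I), c, fun x hx => ?_, fun x y hx hy => ?_⟩
      · obtain ⟨a, ha, l, rfl⟩ := hsplit Y x hx
        rw [(hYe a ha).2 l]
        simpa [hmem l] using hce l
      · obtain ⟨a, ha, l, rfl⟩ := hsplit Y x hx
        obtain ⟨b, hb, l', rfl⟩ := hsplit Y y hy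
        by_cases hab : a = b
        · subst hab
          rw [(hYe a ha).1 l l', hEe]
          simp [glue, Subtype.ext_iff]
        · exact ⟨fun h => absurd h (hdisj a ha b hb hab l l'),
            fun h => absurd (h 0 (Set.mem_insert _ _)) hab⟩

/-- The polarized canonical Erdős–Rado theorem: if `A` has cardinality `(2^λ_r)⁺` and
`≈` is an equivalence relation on `A^{r+1}`, then there are `X₀,…,X_r ⊆ A`, each of
cardinality `λ`, on whose product `≈` is canonical: for some `I ⊆ {0,…,r}`, `x ≈ y`
iff `x i = y i` for all `i ∈ I`. -/
theorem polarized_canonical_erdos_rado {A : Type u} (lam : Cardinal.{u})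
    (hlam : aleph0 ≤ lam) (r : ℕ) (hA : #A = Order.succ (iterExp lam r))
    (E : (Fin (r + 1) → A) → (Fin (r + 1) → A) → Prop) (hE : Equivalence E) :
    ∃ X : Fin (r + 1) → Set A, (∀ i, #(X i) = lam) ∧
      ∃ I : Set (Fin (r + 1)),
        ∀ x y : Fin (r + 1) → A, (∀ i, x i ∈ X i) → (∀ i, y i ∈ X i) →
          (E x y ↔ ∀ i ∈ I, x i = y i) := by
  obtain ⟨X, hX, I, -, -, hI⟩ := polarized_canonical_colored lam hlam r (Γ := PUnit) hA
    (by simpa using one_lt_aleph0.le.trans hlam) (Quotient.mk ⟨E, hE⟩) fun _ => PUnit.unit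
  exact ⟨X, hX, I, fun x y hx hy => Quotient.eq.symm.trans (hI x y hx hy)⟩
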